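/- Let d ≥ 1, let ‖·‖ be any norm on ℝ^d with closed unit ball B(0,1), let ω be a modulus of continuity, and let M be the uncentered maximal operator associated to ‖·‖ acting on Lip(ω, ℝ^d). Then the operator norm of M satisfies ‖M‖_{Op(ω)} = sup_{t > 0} sup_{v : ‖v‖ = 1} inf_{c ∈ ℝ^d, 0 < R ≤ 1 with ‖v − c‖ = R} (1/ω(t)) ∫_{B(0,1)} ω(t‖c + Ru‖) dλ(u)/λ(B(0,1)). -/

import Mathlib

open MeasureTheory Set Filter Topology

/-- The closed ball of the norm-like function `N`, with center `c` and radius `R`. -/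
def nball {d : ℕ} (N : (Fin d → ℝ) → ℝ) (c : Fin d → ℝ) (R : ℝ) : Set (Fin d → ℝ) :=
  {y | N (y - c) ≤ R}

/-- The uncentered Hardy–Littlewood maximal function associated to the norm `N`,
with respect to `d`-dimensional Lebesgue measure. -/
noncomputable def maxFn {d : ℕ} (N : (Fin d → ℝ) → ℝ) (f : (Fin d → ℝ) → ℝ)
    (x : Fin d → ℝ) : ℝ :=
  sSup {a : ℝ | ∃ c : Fin d → ℝ, ∃ R : ℝ, 0 < R ∧ x ∈ nball N c R ∧
    a = ⨍ y in nball N c R, |f y|}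

/-- The modulus of continuity of `g`, with distances measured using `N`. -/
noncomputable def modCont {d : ℕ} (N : (Fin d → ℝ) → ℝ) (g : (Fin d → ℝ) → ℝ) (δ : ℝ) : ℝ :=
  sSup {a : ℝ | ∃ x y : Fin d → ℝ, N (x - y) ≤ δ ∧ a = |g x - g y|}

/-- `N` is a norm on `ℝ^d`. -/
structure IsNorm {d : ℕ} (N : (Fin d → ℝ) → ℝ) : Prop where
  eq_zero_iff : ∀ x, N x = 0 ↔ x = 0
  add_le : ∀ x y, N (x + y) ≤ N x + N y
  smul : ∀ (a : ℝ) (x), N (a • x) = |a| * N x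

/-- `ω` is a modulus of continuity: continuous, nondecreasing, subadditive on `[0,∞)`,
vanishing at `0`, nonnegative, and not identically zero. -/
structure IsModulus (ω : ℝ → ℝ) : Prop where
  nonneg : ∀ t, 0 ≤ t → 0 ≤ ω t
  map_zero : ω 0 = 0
  mono : MonotoneOn ω (Ici 0)
  subadd : ∀ a b, 0 ≤ a → 0 ≤ b → ω (a + b) ≤ ω a + ω b
  cont : ContinuousOn ω (Ici 0)
  nontrivial : ∃ t, 0 < t ∧ ω t ≠ 0

/-- The `Lip(ω)` seminorm of `f`: `sup_{t>0} ω(f,t)/ω(t)`. -/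
noncomputable def lipNorm {d : ℕ} (N : (Fin d → ℝ) → ℝ) (ω : ℝ → ℝ)
    (f : (Fin d → ℝ) → ℝ) : ℝ :=
  sSup {a : ℝ | ∃ t : ℝ, 0 < t ∧ a = modCont N f t / ω t}

/-- The operator norm of the uncentered maximal operator on `Lip(ω)`. -/
noncomputable def opNorm (d : ℕ) (N : (Fin d → ℝ) → ℝ) (ω : ℝ → ℝ) : ℝ :=
  sSup {a : ℝ | ∃ f : (Fin d → ℝ) → ℝ, lipNorm N ω f = 1 ∧ a = lipNorm N ω (maxFn N f)}

/-- The Hölder `α` seminorm of `f`, distances measured with `N`. -/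
noncomputable def holderNorm {d : ℕ} (N : (Fin d → ℝ) → ℝ) (α : ℝ)
    (f : (Fin d → ℝ) → ℝ) : ℝ :=
  sSup {a : ℝ | ∃ x y : Fin d → ℝ, x ≠ y ∧ a = |f x - f y| / N (x - y) ^ α}

/-- The operator norm of the uncentered maximal operator on the Hölder class `Lip_α`. -/
noncomputable def opNormHolder (d : ℕ) (N : (Fin d → ℝ) → ℝ) (α : ℝ) : ℝ :=
  sSup {a : ℝ | ∃ f : (Fin d → ℝ) → ℝ, holderNorm N α f = 1 ∧
    a = holderNorm N α (maxFn N f)}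

namespace IsNorm

variable {d : ℕ} {N : (Fin d → ℝ) → ℝ}

lemma map_zero (hN : IsNorm N) : N 0 = 0 := (hN.eq_zero_iff 0).2 rfl

lemma map_neg (hN : IsNorm N) (x : Fin d → ℝ) : N (-x) = N x := by
  simpa using hN.smul (-1) x

lemma sub_comm (hN : IsNorm N) (x y : Fin d → ℝ) : N (x - y) = N (y - x) := by
  rw [← hN.map_neg, neg_sub]

lemma nonneg (hN : IsNorm N) (x : Fin d → ℝ) : 0 ≤ N x := by
  have h := hN.add_le x (-x)
  rw [add_neg_cancel, hN.map_zero, hN.map_neg] at h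
  linarith

lemma smul_of_nonneg (hN : IsNorm N) {a : ℝ} (ha : 0 ≤ a) (x : Fin d → ℝ) :
    N (a • x) = a * N x := by
  rw [hN.smul, abs_of_nonneg ha]

lemma abs_sub_le (hN : IsNorm N) (x y : Fin d → ℝ) : |N x - N y| ≤ N (x - y) := by
  have h₁ := hN.add_le (x - y) y
  have h₂ := hN.add_le (y - x) x
  rw [hN.sub_comm y x] at h₂
  rw [sub_add_cancel] at h₁ h₂
  exact abs_sub_le_iff.2 ⟨by linarith, by linarith⟩

lemma continuous (hN : IsNorm N) : Continuous N := by
  have h : ConvexOn ℝ univ N :=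
    (Seminorm.of N hN.add_le fun a x => by rw [hN.smul, Real.norm_eq_abs]).convexOn
  exact h.locallyLipschitz.continuous

lemma isCompact_nball (hN : IsNorm N) (c : Fin d → ℝ) (R : ℝ) : IsCompact (nball N c R) := by
  obtain ⟨m, hm, h⟩ := (isCompact_sphere (0 : Fin d → ℝ) 1).exists_forall_le'
    hN.continuous.continuousOn (a := 0) fun x hx =>
      (hN.nonneg x).lt_of_ne fun h0 => by
        rw [eq_comm, hN.eq_zero_iff] at h0
        simp [h0] at hx
  have hbound (x : Fin d → ℝ) : m * ‖x‖ ≤ N x := by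
    rcases eq_or_ne x 0 with rfl | hx
    · simp [hN.map_zero]
    · have hx' : 0 < ‖x‖ := norm_pos_iff.2 hx
      have := h (‖x‖⁻¹ • x) (by simp [norm_smul, hx'.ne'])
      rw [hN.smul_of_nonneg (by positivity), inv_mul_eq_div, le_div_iff₀ hx'] at this
      exact this
  refine Metric.isCompact_of_isClosed_isBounded
    (isClosed_le (hN.continuous.comp (continuous_id.sub continuous_const)) continuous_const) ?_
  refine (Metric.isBounded_closedBall (x := c) (r := R / m)).subset fun y hy => ?_
  rw [mem_closedBall_iff_norm, le_div_iff₀ hm, mul_comm]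
  exact (hbound _).trans hy

lemma measurableSet_nball (hN : IsNorm N) (c : Fin d → ℝ) (R : ℝ) :
    MeasurableSet (nball N c R) :=
  (hN.isCompact_nball c R).isClosed.measurableSet

lemma integrableOn (hN : IsNorm N) {g : (Fin d → ℝ) → ℝ} (hg : Continuous g)
    (c : Fin d → ℝ) (R : ℝ) : IntegrableOn g (nball N c R) :=
  hg.continuousOn.integrableOn_compact (hN.isCompact_nball c R)

lemma measureReal_unit_ball_pos (hN : IsNorm N) : 0 < volume.real (nball N 0 1) := by
  refine ENNReal.toReal_pos (ne_of_gt ?_) (hN.isCompact_nball 0 1).measure_lt_top.ne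
  refine Measure.measure_pos_of_mem_nhds _ (x := 0) ?_
  have : {y | N y < 1} ∈ 𝓝 (0 : Fin d → ℝ) :=
    (isOpen_lt hN.continuous continuous_const).mem_nhds (by simp [hN.map_zero])
  refine mem_of_superset this fun y hy => ?_
  simpa [nball] using hy.le

lemma setAverage_const (hN : IsNorm N) (a : ℝ) : ⨍ _ in nball N 0 1, a = a :=
  MeasureTheory.setAverage_const
    (fun h => hN.measureReal_unit_ball_pos.ne' (by simp [Measure.real, h]))
    (hN.isCompact_nball 0 1).measure_lt_top.ne a

lemma setAverage_mono (hN : IsNorm N) {f g : (Fin d → ℝ) → ℝ} (hf : Continuous f)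
    (hg : Continuous g) (h : ∀ u, N u ≤ 1 → f u ≤ g u) :
    ⨍ u in nball N 0 1, f u ≤ ⨍ u in nball N 0 1, g u := by
  rw [setAverage_eq, setAverage_eq]
  refine smul_le_smul_of_nonneg_left ?_ (inv_nonneg.2 measureReal_nonneg)
  refine setIntegral_mono_on (hN.integrableOn hf 0 1) (hN.integrableOn hg 0 1)
    (hN.measurableSet_nball 0 1) fun u hu => h u ?_
  simpa [nball] using hu

lemma setAverage_add (hN : IsNorm N) {f g : (Fin d → ℝ) → ℝ} (hf : Continuous f)
    (hg : Continuous g) :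
    ⨍ u in nball N 0 1, (f u + g u) = (⨍ u in nball N 0 1, f u) + ⨍ u in nball N 0 1, g u := by
  simp only [setAverage_eq]
  rw [integral_add (hN.integrableOn hf 0 1) (hN.integrableOn hg 0 1), smul_add]

/-- Averages over `N`-balls, pulled back to the unit ball. -/
lemma setAverage_nball (hN : IsNorm N) (g : (Fin d → ℝ) → ℝ) (c : Fin d → ℝ) {R : ℝ}
    (hR : 0 < R) : ⨍ y in nball N c R, g y = ⨍ u in nball N 0 1, g (c + R • u) := by
  have key (h : (Fin d → ℝ) → ℝ) :
      ∫ y in nball N c R, h y = R ^ d * ∫ u in nball N 0 1, h (c + R • u) := by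
    have hset (u : Fin d → ℝ) : c + R • u ∈ nball N c R ↔ u ∈ nball N 0 1 := by
      simp [nball, hN.smul_of_nonneg hR.le, hR]
    have h₁ (u : Fin d → ℝ) : (nball N 0 1).indicator (fun u => h (c + R • u)) u =
        (nball N c R).indicator h (c + R • u) := by
      by_cases hu : u ∈ nball N 0 1
      · rw [indicator_of_mem hu, indicator_of_mem ((hset u).2 hu)]
      · rw [indicator_of_notMem hu, indicator_of_notMem (mt (hset u).1 hu)]
    rw [← integral_indicator (hN.measurableSet_nball 0 1),
      ← integral_indicator (hN.measurableSet_nball c R)]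
    simp_rw [h₁]
    rw [Measure.integral_comp_smul volume (fun y => (nball N c R).indicator h (c + y)) R,
      integral_add_left_eq_self (fun y => (nball N c R).indicator h y) c]
    simp only [Module.finrank_fin_fun, smul_eq_mul]
    rw [abs_of_pos (by positivity), mul_inv_cancel_left₀ (by positivity)]
  have hvol : volume.real (nball N c R) = R ^ d * volume.real (nball N 0 1) := by
    simpa using key fun _ => 1
  rw [setAverage_eq, setAverage_eq, key, hvol, smul_eq_mul, smul_eq_mul]
  have := hN.measureReal_unit_ball_pos
  field_simp

/-- Among the translates of the unit ball, the centred one minimizes the integral of a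
nondecreasing function of the norm. -/
lemma setAverage_le_translate (hN : IsNorm N) {h : ℝ → ℝ} (hm : MonotoneOn h (Ici 0))
    (hc : ContinuousOn h (Ici 0)) (a : Fin d → ℝ) :
    ⨍ u in nball N 0 1, h (N u) ≤ ⨍ u in nball N 0 1, h (N (a + u)) := by
  have hcont : Continuous fun u => h (N u) :=
    hc.comp_continuous hN.continuous hN.nonneg
  have hg : Continuous fun u => h (N u) - h 1 := hcont.sub continuous_const
  have h₁ := hN.setAverage_nball (fun u => h (N u) - h 1) a one_pos
  have h₂ := hN.setAverage_add (f := fun u => h (N (a + u)) - h 1) (g := fun _ => h 1)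
    (hg.comp (continuous_const.add continuous_id)) continuous_const
  have h₃ := hN.setAverage_add (f := fun u => h (N u) - h 1) (g := fun _ => h 1)
    hg continuous_const
  have hvol : volume.real (nball N a 1) = volume.real (nball N 0 1) := by
    have : nball N 0 1 = (fun u => a + u) ⁻¹' nball N a 1 := by ext; simp [nball]
    rw [this, Measure.real, Measure.real, measure_preimage_add]
  simp only [sub_add_cancel, one_smul] at h₁ h₂ h₃
  rw [h₂, h₃, ← h₁]
  gcongr
  rw [setAverage_eq, setAverage_eq, hvol]
  refine smul_le_smul_of_nonneg_left ?_ (inv_nonneg.2 measureReal_nonneg)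
  rw [← integral_indicator (hN.measurableSet_nball 0 1),
    ← integral_indicator (hN.measurableSet_nball a 1)]
  refine integral_mono
    ((hN.integrableOn hg 0 1).integrable_indicator (hN.measurableSet_nball 0 1))
    ((hN.integrableOn hg a 1).integrable_indicator (hN.measurableSet_nball a 1))
    fun u => ?_
  have hle : N u ≤ 1 → h (N u) ≤ h 1 := fun hu => hm (hN.nonneg u) (mem_Ici.2 zero_le_one) hu
  have hge : ¬ N u ≤ 1 → h 1 ≤ h (N u) := fun hu =>
    hm (mem_Ici.2 zero_le_one) (hN.nonneg u) (not_le.1 hu).le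
  have hmem : u ∈ nball N 0 1 ↔ N u ≤ 1 := by simp [nball]
  by_cases hu : N u ≤ 1 <;> by_cases hu' : u ∈ nball N a 1 <;>
    simp only [indicator, hmem, hu, hu', if_true, if_false] <;> grind

end IsNorm

namespace IsModulus

variable {ω : ℝ → ℝ}

lemma pos (hω : IsModulus ω) {t : ℝ} (ht : 0 < t) : 0 < ω t := by
  refine (hω.nonneg t ht.le).lt_of_ne fun h0 => ?_
  obtain ⟨s, hs, hs0⟩ := hω.nontrivial
  have hmul (n : ℕ) : ω (n * t) = 0 := by
    induction n with
    | zero => simpa using hω.map_zero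
    | succ n ih =>
      refine le_antisymm ?_ (hω.nonneg _ (by positivity))
      have := hω.subadd (n * t) t (by positivity) ht.le
      rw [ih, ← h0] at this
      rw [Nat.cast_succ, add_one_mul]
      linarith
  obtain ⟨n, hn⟩ := exists_nat_ge (s / t)
  rw [div_le_iff₀ ht] at hn
  have := hω.mono (mem_Ici.2 hs.le) (mem_Ici.2 (hs.le.trans hn)) hn
  rw [hmul] at this
  exact hs0 (this.antisymm (hω.nonneg s hs.le))

lemma abs_sub_le (hω : IsModulus ω) {a b : ℝ} (ha : 0 ≤ a) (hb : 0 ≤ b) :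
    |ω a - ω b| ≤ ω |a - b| := by
  wlog h : b ≤ a generalizing a b
  · rw [abs_sub_comm, abs_sub_comm a]
    exact this hb ha (le_of_not_ge h)
  rw [abs_of_nonneg (sub_nonneg.2 h), abs_of_nonneg (sub_nonneg.2 (hω.mono hb ha h))]
  have := hω.subadd (a - b) b (sub_nonneg.2 h) hb
  rw [sub_add_cancel] at this
  linarith

lemma continuous_comp (hω : IsModulus ω) {α : Type*} [TopologicalSpace α] {g : α → ℝ}
    (hg : Continuous g) (h0 : ∀ x, 0 ≤ g x) : Continuous fun x => ω (g x) :=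
  hω.cont.comp_continuous hg h0

lemma continuous_of_abs_sub_le (hω : IsModulus ω) {d : ℕ} {N : (Fin d → ℝ) → ℝ}
    (hN : IsNorm N) {f : (Fin d → ℝ) → ℝ} (hf : ∀ x y, |f x - f y| ≤ ω (N (x - y))) :
    Continuous f := by
  refine continuous_iff_continuousAt.2 fun x => tendsto_iff_dist_tendsto_zero.2 ?_
  have h : Tendsto (fun y => ω (N (y - x))) (𝓝 x) (𝓝 0) := by
    have hc : Continuous fun y => ω (N (y - x)) :=
      hω.continuous_comp (hN.continuous.comp (continuous_id.sub continuous_const))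
        fun y => hN.nonneg _
    simpa [hN.map_zero, hω.map_zero] using hc.tendsto x
  exact squeeze_zero (fun _ => dist_nonneg) (fun y => hf y x) h

end IsModulus

section Lipschitz

variable {d : ℕ} {N : (Fin d → ℝ) → ℝ} {ω : ℝ → ℝ} {g : (Fin d → ℝ) → ℝ} {K : ℝ}

lemma modCont_nonneg (N : (Fin d → ℝ) → ℝ) (g : (Fin d → ℝ) → ℝ) (δ : ℝ) :
    0 ≤ modCont N g δ := by
  refine Real.sSup_nonneg ?_
  rintro _ ⟨x, y, -, rfl⟩
  exact abs_nonneg _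

lemma lipNorm_nonneg (hω : IsModulus ω) (N : (Fin d → ℝ) → ℝ) (g : (Fin d → ℝ) → ℝ) :
    0 ≤ lipNorm N ω g := by
  refine Real.sSup_nonneg ?_
  rintro _ ⟨t, ht, rfl⟩
  exact div_nonneg (modCont_nonneg N g t) (hω.nonneg t ht.le)

lemma abs_sub_le_of_norm_le (hN : IsNorm N) (hω : IsModulus ω) (hK : 0 ≤ K)
    (hg : ∀ x y, |g x - g y| ≤ K * ω (N (x - y))) {x y : Fin d → ℝ} {t : ℝ}
    (h : N (x - y) ≤ t) : |g x - g y| ≤ K * ω t :=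
  (hg x y).trans <| mul_le_mul_of_nonneg_left
    (hω.mono (hN.nonneg _) ((hN.nonneg _).trans h) h) hK

lemma modCont_div_le (hN : IsNorm N) (hω : IsModulus ω) (hK : 0 ≤ K)
    (hg : ∀ x y, |g x - g y| ≤ K * ω (N (x - y))) {t : ℝ} (ht : 0 < t) :
    modCont N g t / ω t ≤ K := by
  rw [div_le_iff₀ (hω.pos ht)]
  refine Real.sSup_le ?_ (mul_nonneg hK (hω.nonneg t ht.le))
  rintro _ ⟨x, y, h, rfl⟩
  exact abs_sub_le_of_norm_le hN hω hK hg h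

lemma lipNorm_le (hN : IsNorm N) (hω : IsModulus ω) (hK : 0 ≤ K)
    (hg : ∀ x y, |g x - g y| ≤ K * ω (N (x - y))) : lipNorm N ω g ≤ K := by
  refine Real.sSup_le ?_ hK
  rintro _ ⟨t, ht, rfl⟩
  exact modCont_div_le hN hω hK hg ht

lemma abs_sub_div_le_lipNorm (hN : IsNorm N) (hω : IsModulus ω) (hK : 0 ≤ K)
    (hg : ∀ x y, |g x - g y| ≤ K * ω (N (x - y))) {x y : Fin d → ℝ} {t : ℝ} (ht : 0 < t)
    (h : N (x - y) ≤ t) : |g x - g y| / ω t ≤ lipNorm N ω g := by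
  have h₁ : |g x - g y| ≤ modCont N g t := by
    refine le_csSup ⟨K * ω t, ?_⟩ ⟨x, y, h, rfl⟩
    rintro _ ⟨x, y, h, rfl⟩
    exact abs_sub_le_of_norm_le hN hω hK hg h
  have h₂ : modCont N g t / ω t ≤ lipNorm N ω g := by
    refine le_csSup ⟨K, ?_⟩ ⟨t, ht, rfl⟩
    rintro _ ⟨t, ht, rfl⟩
    exact modCont_div_le hN hω hK hg ht
  exact (div_le_div_of_nonneg_right h₁ (hω.nonneg t ht.le)).trans h₂

/-- A bound on the oscillation at one scale gives a bound at every multiple of that scale. -/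
lemma abs_sub_le_nat_mul (hN : IsNorm N) {s C : ℝ}
    (h : ∀ x y, N (x - y) ≤ s → |g x - g y| ≤ C) (n : ℕ) (x y : Fin d → ℝ)
    (hxy : N (x - y) ≤ n * s) : |g x - g y| ≤ n * C := by
  induction n generalizing x y with
  | zero =>
    have h0 : x - y = 0 := (hN.eq_zero_iff _).1
      (le_antisymm (by simpa using hxy) (hN.nonneg _))
    simp [sub_eq_zero.1 h0]
  | succ n ih =>
    have hn : (0 : ℝ) < n + 1 := by positivity
    push_cast at hxy ⊢
    set q : ℝ := (n + 1 : ℝ)⁻¹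
    have hq : 0 ≤ q := by positivity
    have hxy' : q * N (x - y) ≤ s := by
      rwa [inv_mul_eq_div, div_le_iff₀ hn, mul_comm]
    set z := x - q • (x - y)
    have h₁ : |g x - g z| ≤ C := h _ _ (by
      rw [show x - z = q • (x - y) by simp [z], hN.smul_of_nonneg hq]
      exact hxy')
    have h₂ : |g z - g y| ≤ n * C := ih _ _ (by
      have hz : z - y = (n * q) • (x - y) := by
        rw [show (n : ℝ) * q = 1 - q by simp only [q]; field_simp; ring, sub_smul, one_smul]
        simp only [z]
        abel
      rw [hz, hN.smul_of_nonneg (by positivity), mul_assoc]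
      gcongr)
    calc |g x - g y| ≤ |g x - g z| + |g z - g y| := abs_sub_le _ _ _
      _ ≤ (n + 1) * C := by linarith

/-- Since the seminorm is nonzero, none of the suprema defining it is taken over an unbounded
set. -/
lemma abs_sub_le_of_lipNorm_eq_one (hN : IsNorm N) (hω : IsModulus ω)
    (hg : lipNorm N ω g = 1) (x y : Fin d → ℝ) : |g x - g y| ≤ ω (N (x - y)) := by
  have hfin : ∃ s : ℝ, 0 < s ∧ BddAbove {a : ℝ | ∃ x y, N (x - y) ≤ s ∧ a = |g x - g y|} := by
    by_contra! hunb
    have : lipNorm N ω g ≤ 0 := by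
      refine Real.sSup_le ?_ le_rfl
      rintro _ ⟨t, ht, rfl⟩
      rw [modCont, Real.sSup_of_not_bddAbove (hunb t ht), zero_div]
    linarith
  obtain ⟨s, hs, C, hC⟩ := hfin
  have hbdd (t : ℝ) : BddAbove {a : ℝ | ∃ x y, N (x - y) ≤ t ∧ a = |g x - g y|} := by
    obtain ⟨n, hn⟩ := exists_nat_ge (t / s)
    rw [div_le_iff₀ hs] at hn
    refine ⟨n * C, ?_⟩
    rintro _ ⟨x, y, hxy, rfl⟩
    exact abs_sub_le_nat_mul hN (fun x y h => hC ⟨x, y, h, rfl⟩) n x y (hxy.trans hn)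
  rcases (hN.nonneg (x - y)).eq_or_lt with h0 | h0
  · rw [eq_comm, hN.eq_zero_iff, sub_eq_zero] at h0
    simp [h0, hN.map_zero, hω.map_zero]
  · have hbdd' : BddAbove {a : ℝ | ∃ t : ℝ, 0 < t ∧ a = modCont N g t / ω t} := by
      by_contra hunb
      rw [lipNorm, Real.sSup_of_not_bddAbove hunb] at hg
      exact zero_ne_one hg
    have h₁ : modCont N g (N (x - y)) / ω (N (x - y)) ≤ 1 :=
      hg ▸ le_csSup hbdd' ⟨_, h0, rfl⟩
    rw [div_le_one (hω.pos h0)] at h₁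
    exact (le_csSup (hbdd _) ⟨x, y, le_rfl, rfl⟩).trans h₁

end Lipschitz

section Excess

variable {d : ℕ} {N : (Fin d → ℝ) → ℝ} {ω : ℝ → ℝ} {t : ℝ} {v : Fin d → ℝ}

/-- The infimum appearing in the integral formula for the operator norm. -/
noncomputable def excess (N : (Fin d → ℝ) → ℝ) (ω : ℝ → ℝ) (t : ℝ) (v : Fin d → ℝ) : ℝ :=
  sInf {e : ℝ | ∃ c : Fin d → ℝ, ∃ R : ℝ, 0 < R ∧ R ≤ 1 ∧ N (v - c) = R ∧
    e = (∫ u in nball N 0 1, ω (t * N (c + R • u))) /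
      (ω t * (volume (nball N 0 1)).toReal)}

/-- The supremum of `excess` over all scales and all unit vectors. -/
noncomputable def supExcess (N : (Fin d → ℝ) → ℝ) (ω : ℝ → ℝ) : ℝ :=
  sSup {a : ℝ | ∃ t : ℝ, 0 < t ∧
    a = sSup {b : ℝ | ∃ v : Fin d → ℝ, N v = 1 ∧ b = excess N ω t v}}

lemma integral_div_eq_setAverage_div (g : (Fin d → ℝ) → ℝ) (a : ℝ) :
    (∫ u in nball N 0 1, g u) / (a * (volume (nball N 0 1)).toReal) =
      (⨍ u in nball N 0 1, g u) / a := by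
  rw [setAverage_eq, smul_eq_mul, Measure.real]
  simp only [div_eq_mul_inv, mul_inv]
  ring

lemma IsModulus.continuous_dilate (hω : IsModulus ω) (hN : IsNorm N) (ht : 0 ≤ t)
    (c : Fin d → ℝ) (R : ℝ) : Continuous fun u => ω (t * N (c + R • u)) :=
  hω.continuous_comp
    (continuous_const.mul (hN.continuous.comp
      (continuous_const.add (continuous_const_smul R))))
    fun _ => mul_nonneg ht (hN.nonneg _)

lemma setAverage_dilate_nonneg (hN : IsNorm N) (hω : IsModulus ω) (ht : 0 ≤ t)
    (c : Fin d → ℝ) (R : ℝ) : 0 ≤ ⨍ u in nball N 0 1, ω (t * N (c + R • u)) := by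
  have := hN.setAverage_mono continuous_const (hω.continuous_dilate hN ht c R)
    fun u _ => hω.nonneg _ (mul_nonneg ht (hN.nonneg (c + R • u)))
  rwa [hN.setAverage_const] at this

lemma excess_nonneg (hN : IsNorm N) (hω : IsModulus ω) (ht : 0 ≤ t) :
    0 ≤ excess N ω t v := by
  refine Real.sInf_nonneg ?_
  rintro _ ⟨c, R, -, -, -, rfl⟩
  rw [integral_div_eq_setAverage_div]
  exact div_nonneg (setAverage_dilate_nonneg hN hω ht c R) (hω.nonneg t ht)

lemma excess_le (hN : IsNorm N) (hω : IsModulus ω) (ht : 0 ≤ t) {c : Fin d → ℝ} {R : ℝ}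
    (hR : 0 < R) (hR1 : R ≤ 1) (hc : N (v - c) = R) :
    excess N ω t v ≤ (⨍ u in nball N 0 1, ω (t * N (c + R • u))) / ω t := by
  refine csInf_le ⟨0, ?_⟩ ⟨c, R, hR, hR1, hc, (integral_div_eq_setAverage_div _ _).symm⟩
  rintro _ ⟨c, R, -, -, -, rfl⟩
  rw [integral_div_eq_setAverage_div]
  exact div_nonneg (setAverage_dilate_nonneg hN hω ht c R) (hω.nonneg t ht)

lemma le_excess (hv : N v = 1) {a : ℝ}
    (h : ∀ (c : Fin d → ℝ) (R : ℝ), 0 < R → R ≤ 1 → N (v - c) = R →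
      a ≤ (⨍ u in nball N 0 1, ω (t * N (c + R • u))) / ω t) :
    a ≤ excess N ω t v := by
  refine le_csInf ⟨_, 0, 1, one_pos, le_rfl, by rwa [sub_zero], rfl⟩ ?_
  rintro _ ⟨c, R, hR, hR1, hc, rfl⟩
  rw [integral_div_eq_setAverage_div]
  exact h c R hR hR1 hc

lemma excess_le_one (hN : IsNorm N) (hω : IsModulus ω) (ht : 0 < t) (hv : N v = 1) :
    excess N ω t v ≤ 1 := by
  refine (excess_le hN hω ht.le one_pos le_rfl (c := 0) (by rwa [sub_zero])).trans ?_
  rw [div_le_one (hω.pos ht)]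
  have := hN.setAverage_mono (hω.continuous_dilate hN ht.le 0 1) continuous_const
    fun u hu => hω.mono (mul_nonneg ht.le (hN.nonneg _)) (mem_Ici.2 ht.le) (by
      rw [zero_add, one_smul]
      exact mul_le_of_le_one_right ht.le hu)
  rwa [hN.setAverage_const] at this

lemma supExcess_nonneg (hN : IsNorm N) (hω : IsModulus ω) : 0 ≤ supExcess N ω := by
  refine Real.sSup_nonneg ?_
  rintro _ ⟨t, ht, rfl⟩
  refine Real.sSup_nonneg ?_
  rintro _ ⟨v, -, rfl⟩
  exact excess_nonneg hN hω ht.le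

lemma excess_le_supExcess (hN : IsNorm N) (hω : IsModulus ω) (ht : 0 < t) (hv : N v = 1) :
    excess N ω t v ≤ supExcess N ω := by
  have h₁ : excess N ω t v ≤ sSup {b : ℝ | ∃ v, N v = 1 ∧ b = excess N ω t v} := by
    refine le_csSup ⟨1, ?_⟩ ⟨v, hv, rfl⟩
    rintro _ ⟨v, hv, rfl⟩
    exact excess_le_one hN hω ht hv
  refine h₁.trans (le_csSup ⟨1, ?_⟩ ⟨t, ht, rfl⟩)
  rintro _ ⟨t, ht, rfl⟩
  refine Real.sSup_le ?_ zero_le_one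
  rintro _ ⟨v, hv, rfl⟩
  exact excess_le_one hN hω ht hv

end Excess

section MaximalFunction

variable {d : ℕ} {N : (Fin d → ℝ) → ℝ} {ω : ℝ → ℝ} {f : (Fin d → ℝ) → ℝ}

/-- The averages of `|f|` over the balls containing `x`. -/
def ballAverages (N : (Fin d → ℝ) → ℝ) (f : (Fin d → ℝ) → ℝ) (x : Fin d → ℝ) : Set ℝ :=
  {a : ℝ | ∃ c : Fin d → ℝ, ∃ R : ℝ, 0 < R ∧ x ∈ nball N c R ∧ a = ⨍ y in nball N c R, |f y|}

lemma ballAverages_nonempty (hN : IsNorm N) (x : Fin d → ℝ) : (ballAverages N f x).Nonempty :=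
  ⟨_, x, 1, one_pos, by simp [nball, hN.map_zero], rfl⟩

/-- Transporting a ball containing `x` to a ball containing `x + t • v`. -/
lemma exists_ballAverages_ge (hN : IsNorm N) (hω : IsModulus ω)
    (hf : ∀ x y, |f x - f y| ≤ ω (N (x - y))) {t : ℝ} (ht : 0 < t) {x v c : Fin d → ℝ} {R : ℝ}
    (hR : 0 < R) (hc : N (v - c) = R) {a : ℝ} (ha : a ∈ ballAverages N f x) :
    ∃ b ∈ ballAverages N f (x + t • v),
      a ≤ b + ⨍ u in nball N 0 1, ω (t * N (c + R • u)) := by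
  obtain ⟨z, r, hr, hx, rfl⟩ := ha
  have hcont := (hω.continuous_of_abs_sub_le hN hf).abs
  have hr' : 0 < r + t * R := by positivity
  have haff (p : Fin d → ℝ) (q : ℝ) : Continuous fun u => |f (p + q • u)| :=
    hcont.comp (continuous_const.add (continuous_const_smul q))
  refine ⟨_, ⟨z + t • c, r + t * R, hr', ?_, rfl⟩, ?_⟩
  · have hsub : x + t • v - (z + t • c) = (x - z) + t • (v - c) := by
      rw [smul_sub]
      abel
    have := hN.add_le (x - z) (t • (v - c))
    rw [hN.smul_of_nonneg ht.le, hc] at this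
    simp only [nball, mem_ofPred_eq] at hx ⊢
    rw [hsub]
    linarith
  · rw [hN.setAverage_nball _ z hr, hN.setAverage_nball _ _ hr',
      ← hN.setAverage_add (haff _ _) (hω.continuous_dilate hN ht.le c R)]
    refine hN.setAverage_mono (haff _ _)
      ((haff _ _).add (hω.continuous_dilate hN ht.le c R)) fun u _ => ?_
    have hsub : z + t • c + (r + t * R) • u - (z + r • u) = t • (c + R • u) := by
      rw [smul_add, smul_smul, add_smul]
      abel
    have h₁ := hf (z + t • c + (r + t * R) • u) (z + r • u)
    rw [hsub, hN.smul_of_nonneg ht.le, abs_sub_comm] at h₁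
    have h₂ := abs_sub_abs_le_abs_sub (f (z + r • u)) (f (z + t • c + (r + t * R) • u))
    linarith

lemma ballAverages_le (hN : IsNorm N) (hω : IsModulus ω)
    (hf : ∀ x y, |f x - f y| ≤ ω (N (x - y))) {x y : Fin d → ℝ}
    (hy : BddAbove (ballAverages N f y)) {a : ℝ} (ha : a ∈ ballAverages N f x) :
    a ≤ maxFn N f y + supExcess N ω * ω (N (x - y)) := by
  rcases (hN.nonneg (y - x)).eq_or_lt with h0 | ht
  · rw [eq_comm, hN.eq_zero_iff, sub_eq_zero] at h0
    subst h0
    rw [sub_self, hN.map_zero, hω.map_zero, mul_zero, add_zero]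
    exact le_csSup hy ha
  rw [hN.sub_comm x y]
  set t := N (y - x) with ht_def
  set v := t⁻¹ • (y - x) with hv_def
  have hv : N v = 1 := by
    rw [hv_def, hN.smul_of_nonneg (by positivity), ← ht_def, inv_mul_cancel₀ ht.ne']
  have hxy : x + t • v = y := by
    rw [hv_def, smul_inv_smul₀ ht.ne']
    abel
  have hωt := hω.pos ht
  have key : (a - maxFn N f y) / ω t ≤ excess N ω t v := by
    refine le_excess hv fun c R hR _ hc => ?_
    obtain ⟨b, hb, hab⟩ := exists_ballAverages_ge hN hω hf ht hR hc ha
    rw [hxy] at hb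
    have : b ≤ maxFn N f y := le_csSup hy hb
    gcongr
    linarith
  have := key.trans (excess_le_supExcess hN hω ht hv)
  rw [div_le_iff₀ hωt] at this
  linarith

/-- The maximal function of a function in the unit ball of `Lip(ω)` has seminorm at most
`supExcess N ω`; when it is infinite, it is so everywhere and `maxFn` vanishes identically. -/
lemma abs_maxFn_sub_le (hN : IsNorm N) (hω : IsModulus ω)
    (hf : ∀ x y, |f x - f y| ≤ ω (N (x - y))) (x y : Fin d → ℝ) :
    |maxFn N f x - maxFn N f y| ≤ supExcess N ω * ω (N (x - y)) := by
  have hbdd {x y : Fin d → ℝ} (hy : BddAbove (ballAverages N f y)) :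
      BddAbove (ballAverages N f x) := ⟨_, fun _ ha => ballAverages_le hN hω hf hy ha⟩
  by_cases hx : BddAbove (ballAverages N f x)
  · have h₁ : maxFn N f x ≤ maxFn N f y + supExcess N ω * ω (N (x - y)) :=
      csSup_le (ballAverages_nonempty hN x) fun _ ha => ballAverages_le hN hω hf (hbdd hx) ha
    have h₂ : maxFn N f y ≤ maxFn N f x + supExcess N ω * ω (N (y - x)) :=
      csSup_le (ballAverages_nonempty hN y) fun _ ha => ballAverages_le hN hω hf hx ha
    rw [hN.sub_comm y x] at h₂
    exact abs_sub_le_iff.2 ⟨by linarith, by linarith⟩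
  · have h₁ : maxFn N f x = 0 := Real.sSup_of_not_bddAbove hx
    have h₂ : maxFn N f y = 0 := Real.sSup_of_not_bddAbove (mt hbdd hx)
    rw [h₁, h₂, sub_zero, abs_zero]
    exact mul_nonneg (supExcess_nonneg hN hω) (hω.nonneg _ (hN.nonneg _))

end MaximalFunction

section Extremizer

variable {d : ℕ} {N : (Fin d → ℝ) → ℝ} {ω : ℝ → ℝ}

/-- To minimize the average of a nondecreasing function of the norm over the balls containing a
unit vector `v`, it suffices to consider balls of radius at most one with `v` on the boundary. -/
lemma exists_setAverage_le (hN : IsNorm N) {φ : ℝ → ℝ} (hm : MonotoneOn φ (Ici 0))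
    (hφ : ContinuousOn φ (Ici 0)) {v c : Fin d → ℝ} {R : ℝ} (hv : N v = 1) (hR : 0 < R)
    (hc : N (v - c) ≤ R) :
    ∃ (c' : Fin d → ℝ) (R' : ℝ), 0 < R' ∧ R' ≤ 1 ∧ N (v - c') = R' ∧
      ⨍ u in nball N 0 1, φ (N (c' + R' • u)) ≤ ⨍ u in nball N 0 1, φ (N (c + R • u)) := by
  have hcont (p : Fin d → ℝ) (q : ℝ) : Continuous fun u => φ (N (p + q • u)) :=
    hφ.comp_continuous (hN.continuous.comp (continuous_const.add (continuous_const_smul q)))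
      fun _ => hN.nonneg _
  have hg : Continuous fun s : ℝ => N (v - s • c) - s * R :=
    (hN.continuous.comp (continuous_const.sub (continuous_id.smul continuous_const))).sub
      (continuous_id.mul continuous_const)
  obtain ⟨s, ⟨hs0, hs1⟩, hs⟩ := intermediate_value_Icc' zero_le_one hg.continuousOn
    (show (0 : ℝ) ∈ Icc _ _ by simp [hv, hc])
  have hs' : 0 < s := hs0.lt_of_ne fun h => by simp [← h, hv] at hs
  have hvs : N (v - s • c) = s * R := sub_eq_zero.1 hs
  have hshrink : ⨍ u in nball N 0 1, φ (N (s • c + (s * R) • u)) ≤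
      ⨍ u in nball N 0 1, φ (N (c + R • u)) := by
    refine hN.setAverage_mono (hcont _ _) (hcont _ _) fun u _ =>
      hm (hN.nonneg _) (hN.nonneg _) ?_
    rw [mul_smul, ← smul_add, hN.smul_of_nonneg hs0]
    exact mul_le_of_le_one_left (hN.nonneg _) hs1
  have hsR : 0 < s * R := mul_pos hs' hR
  rcases le_total (s * R) 1 with h1 | h1
  · exact ⟨s • c, s * R, hsR, h1, hvs, hshrink⟩
  · refine ⟨0, 1, one_pos, le_rfl, by rwa [sub_zero], le_trans ?_ hshrink⟩
    have hm' : MonotoneOn (fun r => φ (s * R * r)) (Ici 0) := fun a ha b hb hab =>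
      hm (mul_nonneg hsR.le ha) (mul_nonneg hsR.le hb) (mul_le_mul_of_nonneg_left hab hsR.le)
    have hφ' : ContinuousOn (fun r => φ (s * R * r)) (Ici 0) :=
      hφ.comp (continuous_const.mul continuous_id).continuousOn
        fun r hr => mul_nonneg hsR.le hr
    have h₁ := hN.setAverage_le_translate hm' hφ' ((s * R)⁻¹ • s • c)
    have h₂ (u : Fin d → ℝ) :
        s * R * N ((s * R)⁻¹ • s • c + u) = N (s • c + (s * R) • u) := by
      rw [← hN.smul_of_nonneg hsR.le, smul_add, smul_inv_smul₀ hsR.ne']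
    simp only [h₂] at h₁
    refine le_trans (hN.setAverage_mono (hcont _ _) ?_ fun u _ => ?_) h₁
    · exact hφ'.comp_continuous hN.continuous hN.nonneg
    · rw [zero_add, one_smul]
      exact hm (hN.nonneg _) (mul_nonneg hsR.le (hN.nonneg _))
        (le_mul_of_one_le_left (hN.nonneg _) h1)

/-- The truncated peak `x ↦ ω(T) - ω(min(‖x‖, T))`. -/
noncomputable def peak (N : (Fin d → ℝ) → ℝ) (ω : ℝ → ℝ) (T : ℝ) (x : Fin d → ℝ) : ℝ :=
  ω T - ω (min (N x) T)

variable {T : ℝ}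

lemma peak_nonneg (hN : IsNorm N) (hω : IsModulus ω) (hT : 0 ≤ T) (x : Fin d → ℝ) :
    0 ≤ peak N ω T x :=
  sub_nonneg.2 (hω.mono (le_min (hN.nonneg x) hT) hT (min_le_right _ _))

lemma peak_le (hN : IsNorm N) (hω : IsModulus ω) (hT : 0 ≤ T) (x : Fin d → ℝ) :
    peak N ω T x ≤ ω T :=
  sub_le_self _ (hω.nonneg _ (le_min (hN.nonneg x) hT))

lemma peak_zero (hN : IsNorm N) (hω : IsModulus ω) (hT : 0 ≤ T) : peak N ω T 0 = ω T := by
  rw [peak, hN.map_zero, min_eq_left hT, hω.map_zero, sub_zero]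

lemma abs_peak_sub_le (hN : IsNorm N) (hω : IsModulus ω) (hT : 0 ≤ T) (x y : Fin d → ℝ) :
    |peak N ω T x - peak N ω T y| ≤ ω (N (x - y)) := by
  have hmin (z : Fin d → ℝ) : 0 ≤ min (N z) T := le_min (hN.nonneg z) hT
  rw [peak, peak, sub_sub_sub_cancel_left]
  refine (hω.abs_sub_le (hmin y) (hmin x)).trans
    (hω.mono (mem_Ici.2 (abs_nonneg _)) (hN.nonneg _) ?_)
  rw [abs_sub_comm]
  refine (abs_min_sub_min_le_max _ _ _ _).trans ?_
  rw [sub_self, abs_zero, max_eq_left (abs_nonneg _)]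
  exact hN.abs_sub_le x y

lemma continuous_peak (hN : IsNorm N) (hω : IsModulus ω) (hT : 0 ≤ T) :
    Continuous (peak N ω T) :=
  hω.continuous_of_abs_sub_le hN (abs_peak_sub_le hN hω hT)

lemma abs_peak (hN : IsNorm N) (hω : IsModulus ω) (hT : 0 ≤ T) (x : Fin d → ℝ) :
    |peak N ω T x| = peak N ω T x :=
  abs_of_nonneg (peak_nonneg hN hω hT x)

lemma lipNorm_peak (hN : IsNorm N) (hω : IsModulus ω) (hT : 0 < T) {v : Fin d → ℝ}
    (hv : N v = 1) : lipNorm N ω (peak N ω T) = 1 := by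
  have hlip (x y : Fin d → ℝ) : |peak N ω T x - peak N ω T y| ≤ 1 * ω (N (x - y)) := by
    rw [one_mul]
    exact abs_peak_sub_le hN hω hT.le x y
  refine le_antisymm (lipNorm_le hN hω zero_le_one hlip) ?_
  have hT' : N (T • v) = T := by rw [hN.smul_of_nonneg hT.le, hv, mul_one]
  have h := abs_sub_div_le_lipNorm hN hω zero_le_one hlip hT
    (x := T • v) (y := 0) (by rw [sub_zero, hT'])
  rwa [peak_zero hN hω hT.le, peak, hT', min_self, sub_self, zero_sub, abs_neg,
    abs_of_pos (hω.pos hT), div_self (hω.pos hT).ne'] at h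

lemma setAverage_peak_le (hN : IsNorm N) (hω : IsModulus ω) (hT : 0 ≤ T) (c : Fin d → ℝ)
    {R : ℝ} (hR : 0 < R) : ⨍ y in nball N c R, |peak N ω T y| ≤ ω T := by
  have hcont : Continuous fun u => |peak N ω T (c + R • u)| :=
    (continuous_peak hN hω hT).abs.comp (continuous_const.add (continuous_const_smul R))
  rw [hN.setAverage_nball _ c hR]
  refine (hN.setAverage_mono hcont continuous_const fun u _ => ?_).trans
    (hN.setAverage_const (ω T)).le
  rw [abs_peak hN hω hT]
  exact peak_le hN hω hT _

lemma maxFn_peak_zero_ge (hN : IsNorm N) (hω : IsModulus ω) (hT : 0 ≤ T) :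
    ω T ≤ maxFn N (peak N ω T) 0 := by
  have hbdd : BddAbove (ballAverages N (peak N ω T) 0) := by
    refine ⟨ω T, ?_⟩
    rintro _ ⟨c, R, hR, -, rfl⟩
    exact setAverage_peak_le hN hω hT c hR
  have hle (r : ℝ) (hr : r ∈ Ioi 0) : ω T - ω r ≤ maxFn N (peak N ω T) 0 := by
    rw [mem_Ioi] at hr
    refine le_trans ?_ (le_csSup hbdd ⟨0, r, hr, by simp [nball, hN.map_zero, hr.le], rfl⟩)
    have hcont : Continuous fun u : Fin d → ℝ => |peak N ω T (0 + r • u)| :=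
      (continuous_peak hN hω hT).abs.comp (continuous_const.add (continuous_const_smul r))
    rw [hN.setAverage_nball _ 0 hr]
    refine (hN.setAverage_const _).ge.trans
      (hN.setAverage_mono continuous_const hcont fun u hu => ?_)
    rw [abs_peak hN hω hT, zero_add]
    refine sub_le_sub_left (hω.mono (le_min (hN.nonneg _) hT) (mem_Ici.2 hr.le)
      ((min_le_left _ _).trans ?_)) _
    rw [hN.smul_of_nonneg hr.le]
    exact mul_le_of_le_one_right hr.le hu
  have hlim : Tendsto (fun r => ω T - ω r) (𝓝[>] 0) (𝓝 (ω T - 0)) := by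
    refine tendsto_const_nhds.sub ?_
    have := (hω.cont 0 self_mem_Ici).mono_left (nhdsWithin_mono 0 Ioi_subset_Ici_self)
    rwa [hω.map_zero] at this
  rw [sub_zero] at hlim
  exact le_of_tendsto hlim (eventually_mem_nhdsWithin.mono hle)

lemma maxFn_peak_le (hN : IsNorm N) (hω : IsModulus ω) {t : ℝ} (ht : 0 < t) {v : Fin d → ℝ}
    (hv : N v = 1) :
    maxFn N (peak N ω (3 * t)) (t • v) ≤ ω (3 * t) - ω t * excess N ω t v := by
  have hT : 0 ≤ 3 * t := by positivity
  refine csSup_le (ballAverages_nonempty hN _) ?_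
  rintro _ ⟨z, r, hr, hz, rfl⟩
  set φ : ℝ → ℝ := fun s => ω (min (t * s) (3 * t)) with hφ_def
  have hmem {s : ℝ} (hs : s ∈ Ici 0) : min (t * s) (3 * t) ∈ Ici (0 : ℝ) :=
    le_min (mul_nonneg ht.le hs) hT
  have hm : MonotoneOn φ (Ici 0) := fun a ha b hb hab =>
    hω.mono (hmem ha) (hmem hb) (min_le_min_right _ (mul_le_mul_of_nonneg_left hab ht.le))
  have hφ : ContinuousOn φ (Ici 0) :=
    hω.cont.comp ((continuous_const.mul continuous_id).min continuous_const).continuousOn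
      fun s hs => hmem hs
  have hφN (p : Fin d → ℝ) (q : ℝ) : Continuous fun u => φ (N (p + q • u)) :=
    hφ.comp_continuous (hN.continuous.comp (continuous_const.add (continuous_const_smul q)))
      fun _ => hN.nonneg _
  have hvc : N (v - t⁻¹ • z) ≤ r / t := by
    rw [le_div_iff₀ ht, mul_comm, ← hN.smul_of_nonneg ht.le, smul_sub, smul_inv_smul₀ ht.ne']
    exact hz
  obtain ⟨c, R, hR, hR1, hc, hle⟩ := exists_setAverage_le hN hm hφ hv (div_pos hr ht) hvc
  have hexcess : ω t * excess N ω t v ≤ ⨍ u in nball N 0 1, φ (N (c + R • u)) := by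
    have h₁ := excess_le hN hω ht.le hR hR1 hc
    rw [le_div_iff₀ (hω.pos ht), mul_comm] at h₁
    refine h₁.trans (hN.setAverage_mono (hω.continuous_dilate hN ht.le c R) (hφN c R)
      fun u hu => le_of_eq ?_)
    have h₂ : N (c + R • u) ≤ 3 := by
      have h₃ := hN.add_le (v - (v - c)) (R • u)
      have h₄ := hN.add_le v (-(v - c))
      rw [← sub_eq_add_neg, hN.map_neg, hv, hc] at h₄
      rw [hN.smul_of_nonneg hR.le] at h₃
      rw [sub_sub_cancel] at h₃ h₄
      nlinarith [mul_le_of_le_one_right hR.le hu]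
    simp only [hφ_def]
    rw [min_eq_left (by nlinarith)]
  have havg : (⨍ y in nball N z r, |peak N ω (3 * t) y|) +
      ⨍ u in nball N 0 1, φ (N (t⁻¹ • z + (r / t) • u)) = ω (3 * t) := by
    have hp : Continuous fun u => |peak N ω (3 * t) (z + r • u)| :=
      (continuous_peak hN hω hT).abs.comp (continuous_const.add (continuous_const_smul r))
    have hsum (u : Fin d → ℝ) :
        |peak N ω (3 * t) (z + r • u)| + φ (N (t⁻¹ • z + (r / t) • u)) = ω (3 * t) := by
      have : t * N (t⁻¹ • z + (r / t) • u) = N (z + r • u) := by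
        rw [← hN.smul_of_nonneg ht.le, smul_add, smul_inv_smul₀ ht.ne', smul_smul,
          mul_div_cancel₀ _ ht.ne']
      simp only [hφ_def]
      rw [abs_peak hN hω hT, this, peak, sub_add_cancel]
    rw [hN.setAverage_nball _ z hr, ← hN.setAverage_add hp (hφN _ _)]
    simp_rw [hsum]
    exact hN.setAverage_const _
  linarith

lemma excess_le_lipNorm_maxFn_peak (hN : IsNorm N) (hω : IsModulus ω) {t : ℝ} (ht : 0 < t)
    {v : Fin d → ℝ} (hv : N v = 1) :
    excess N ω t v ≤ lipNorm N ω (maxFn N (peak N ω (3 * t))) := by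
  have hT : 0 ≤ 3 * t := by positivity
  have h₁ := maxFn_peak_zero_ge hN hω hT
  have h₂ := maxFn_peak_le hN hω ht hv
  refine le_trans ?_ (abs_sub_div_le_lipNorm hN hω (supExcess_nonneg hN hω)
    (abs_maxFn_sub_le hN hω (abs_peak_sub_le hN hω hT)) ht (x := 0) (y := t • v) ?_)
  · rw [le_div_iff₀ (hω.pos ht), mul_comm]
    exact le_trans (by linarith) (le_abs_self _)
  · rw [zero_sub, hN.map_neg, hN.smul_of_nonneg ht.le, hv, mul_one]

end Extremizer

/-- Integral formula for the operator norm of the uncentered maximal operator on `Lip(ω)`: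
`‖M‖ = sup_{t>0} sup_{‖v‖=1} inf_{‖v-c‖=R≤1} (1/ω(t)) ⨍_{B(0,1)} ω(t‖c+Ru‖) du`. -/
theorem stmt3 (d : ℕ) (hd : 1 ≤ d) (N : (Fin d → ℝ) → ℝ) (hN : IsNorm N)
    (ω : ℝ → ℝ) (hω : IsModulus ω) :
    opNorm d N ω =
      sSup {a : ℝ | ∃ t : ℝ, 0 < t ∧
        a = sSup {b : ℝ | ∃ v : Fin d → ℝ, N v = 1 ∧
          b = sInf {e : ℝ | ∃ c : Fin d → ℝ, ∃ R : ℝ, 0 < R ∧ R ≤ 1 ∧ N (v - c) = R ∧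
            e = (∫ u in nball N 0 1, ω (t * N (c + R • u))) /
                  (ω t * (volume (nball N 0 1)).toReal)}}} := by
  change opNorm d N ω = supExcess N ω
  have hle {f : (Fin d → ℝ) → ℝ} (hf : lipNorm N ω f = 1) :
      lipNorm N ω (maxFn N f) ≤ supExcess N ω :=
    lipNorm_le hN hω (supExcess_nonneg hN hω)
      (abs_maxFn_sub_le hN hω (abs_sub_le_of_lipNorm_eq_one hN hω hf))
  have hnonneg : 0 ≤ opNorm d N ω := by
    refine Real.sSup_nonneg ?_
    rintro _ ⟨f, -, rfl⟩
    exact lipNorm_nonneg hω N _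
  refine le_antisymm (Real.sSup_le ?_ (supExcess_nonneg hN hω)) (Real.sSup_le ?_ hnonneg)
  · rintro _ ⟨f, hf, rfl⟩
    exact hle hf
  · rintro _ ⟨t, ht, rfl⟩
    refine Real.sSup_le ?_ hnonneg
    rintro _ ⟨v, hv, rfl⟩
    refine (excess_le_lipNorm_maxFn_peak hN hω ht hv).trans (le_csSup ⟨supExcess N ω, ?_⟩
      ⟨_, lipNorm_peak hN hω (by positivity) hv, rfl⟩)
    rintro _ ⟨f, hf, rfl⟩
    exact hle hf
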